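/- Let X_1,…,X_n be i.i.d. from a fixed distribution on ℝ^d (d fixed, not varying with n) with mean μ = 0 and positive definite covariance Σ, and let n = 2m with μ̂_1 = m^{-1}∑_{i=1}^m X_i, μ̂_2 = m^{-1}∑_{i=m+1}^n X_i. Then the cross-fitted statistic T_mean^cross = √m μ̂_1ᵀμ̂_2 / sqrt( m^{-1}∑_{i=1}^m ( μ̂_2ᵀ(X_i − μ̂_1) )² ) + √m μ̂_2ᵀμ̂_1 / sqrt( m^{-1}∑_{i=m+1}^n ( μ̂_1ᵀ(X_i − μ̂_2) )² ) converges in distribution, as m → ∞, to ξ_1ᵀΣξ_2/√(ξ_1ᵀΣ²ξ_1) + ξ_1ᵀΣξ_2/√(ξ_2ᵀΣ²ξ_2), where ξ_1, ξ_2 are i.i.d. N(0, I_d). (In particular, the limit is not Gaussian.) -/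

import Mathlib

/-!
Statement 14: Limiting null distribution of the cross-fitted mean statistic
(Proposition 5 of Kim & Ramdas).  For a fixed-dimensional distribution with mean `0`
and positive definite covariance `Σ`, the cross-fitted statistic `T_mean^cross`
converges in distribution (as `m → ∞`, `n = 2m`) to
`ξ₁ᵀΣξ₂/√(ξ₁ᵀΣ²ξ₁) + ξ₁ᵀΣξ₂/√(ξ₂ᵀΣ²ξ₂)` with `ξ₁, ξ₂` i.i.d. `N(0, I_d)`.
Convergence in distribution is expressed via bounded continuous test functions.
-/

open MeasureTheory ProbabilityTheory Filter

noncomputable section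

/-- Euclidean dot product on `Fin d → ℝ`. -/
def dot {d : ℕ} (x y : Fin d → ℝ) : ℝ := ∑ i, x i * y i

/-- The cross-fitted statistic `T_mean^cross` with balanced split `m₁ = m₂ = m`. -/
def TmeanCross (d m : ℕ) (ω : Fin (m + m) → Fin d → ℝ) : ℝ :=
  let μ1 : Fin d → ℝ := fun j => (∑ i : Fin m, ω (Fin.castAdd m i) j) / m
  let μ2 : Fin d → ℝ := fun j => (∑ i : Fin m, ω (Fin.natAdd m i) j) / m
  Real.sqrt m * dot μ1 μ2 /
      Real.sqrt ((∑ i : Fin m, dot μ2 (fun j => ω (Fin.castAdd m i) j - μ1 j) ^ 2) / m) +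
    Real.sqrt m * dot μ2 μ1 /
      Real.sqrt ((∑ i : Fin m, dot μ1 (fun j => ω (Fin.natAdd m i) j - μ2 j) ^ 2) / m)

/-- The standard Gaussian measure `N(0, I_d)` on `ℝ^d`. -/
def stdGaussian (d : ℕ) : Measure (Fin d → ℝ) :=
  Measure.pi fun _ => gaussianReal 0 1


open scoped Topology BoundedContinuousFunction

lemma aux_cont_map {E : Type*} [TopologicalSpace E] [MeasurableSpace E] [BorelSpace E]
    [HasOuterApproxClosed E] {μs : ℕ → ProbabilityMeasure E} {μ : ProbabilityMeasure E}
    (h : Tendsto μs atTop (𝓝 μ)) {F : E → ℝ} (hF : Measurable F) {U : Set E} (hU : IsOpen U)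
    (hcont : ContinuousOn F U) (hμ : ∀ᵐ x ∂(μ : Measure E), x ∈ U) (g : ℝ →ᵇ ℝ) :
    Tendsto (fun n => ∫ x, g (F x) ∂(μs n : Measure E)) atTop
      (𝓝 (∫ x, g (F x) ∂(μ : Measure E))) := by
  have key : Tendsto (fun n => (μs n).map hF.aemeasurable) atTop (𝓝 (μ.map hF.aemeasurable)) := by
    apply tendsto_of_forall_isOpen_le_liminf'
    intro G hG
    have h1 : IsOpen (U ∩ F ⁻¹' G) := hcont.isOpen_inter_preimage hU hG
    have h2 := ProbabilityMeasure.le_liminf_measure_open_of_tendsto h h1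
    simp only [ProbabilityMeasure.toMeasure_map]
    simp_rw [Measure.map_apply hF hG.measurableSet]
    have h3 : (μ : Measure E) (F ⁻¹' G) = (μ : Measure E) (U ∩ F ⁻¹' G) := by
      apply measure_congr
      filter_upwards [hμ] with x hx
      have : (U ∩ F ⁻¹' G) x ↔ (F ⁻¹' G) x := ⟨fun q => q.2, fun q => ⟨hx, q⟩⟩
      exact (propext this).symm
    rw [h3]
    refine h2.trans ?_
    refine liminf_le_liminf (Eventually.of_forall fun n => measure_mono Set.inter_subset_right)
  rw [ProbabilityMeasure.tendsto_iff_forall_integral_tendsto] at key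
  have := key g
  simp only [ProbabilityMeasure.toMeasure_map] at this
  have e : ∀ ν : Measure E, ∫ x, g x ∂(ν.map F) = ∫ x, g (F x) ∂ν := fun ν =>
    integral_map hF.aemeasurable g.continuous.aestronglyMeasurable
  simpa only [e] using this

lemma dot_eq {d : ℕ} (x y : Fin d → ℝ) : dot x y = x ⬝ᵥ y := rfl

lemma iindep_eval {d : ℕ} (P : Measure (Fin d → ℝ)) [IsProbabilityMeasure P]
    {β : Type*} [MeasurableSpace β] (f : (Fin d → ℝ) → β) (hf : Measurable f) :
    iIndepFun (fun k (ω : ℕ → Fin d → ℝ) => f (ω k)) (Measure.infinitePi fun _ => P) :=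
  iIndepFun_infinitePi (X := fun _ x => f x) (fun _ => hf)

lemma map_eval_f {d : ℕ} (P : Measure (Fin d → ℝ)) [IsProbabilityMeasure P]
    {β : Type*} [MeasurableSpace β] (f : (Fin d → ℝ) → β) (hf : Measurable f) (k : ℕ) :
    (Measure.infinitePi fun _ : ℕ => P).map (fun ω => f (ω k)) = P.map f := by
  have := Measure.infinitePi_map_eval (fun _ : ℕ => P) k
  conv_rhs => rw [← this]
  rw [Measure.map_map hf (by fun_prop)]
  rfl

lemma ident_eval {d : ℕ} (P : Measure (Fin d → ℝ)) [IsProbabilityMeasure P]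
    {β : Type*} [MeasurableSpace β] (f : (Fin d → ℝ) → β) (hf : Measurable f) (k : ℕ) :
    IdentDistrib (fun ω : ℕ → Fin d → ℝ => f (ω k)) (fun ω : ℕ → Fin d → ℝ => f (ω 0))
      (Measure.infinitePi fun _ => P) (Measure.infinitePi fun _ => P) where
  aemeasurable_fst := Measurable.aemeasurable (by fun_prop)
  aemeasurable_snd := Measurable.aemeasurable (by fun_prop)
  map_eq := by rw [map_eval_f P f hf, map_eval_f P f hf]

lemma integral_eval_f {d : ℕ} (P : Measure (Fin d → ℝ)) [IsProbabilityMeasure P]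
    (f : (Fin d → ℝ) → ℝ) (hf : Measurable f) (k : ℕ) :
    ∫ ω, f (ω k) ∂(Measure.infinitePi fun _ : ℕ => P) = ∫ x, f x ∂P := by
  have h := (measurePreserving_eval_infinitePi (fun _ : ℕ => P) k)
  have e := integral_map (μ := Measure.infinitePi fun _ : ℕ => P) (f := f)
    h.measurable.aemeasurable hf.aestronglyMeasurable
  rw [h.map_eq] at e
  exact e.symm

lemma lln_real {d : ℕ} (P : Measure (Fin d → ℝ)) [IsProbabilityMeasure P]
    (f : (Fin d → ℝ) → ℝ) (hf : Measurable f) (hi : Integrable f P) :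
    ∀ᵐ ω ∂(Measure.infinitePi fun _ : ℕ => P),
      Tendsto (fun n : ℕ => (∑ i : Fin n, f (ω i)) / n) atTop (𝓝 (∫ x, f x ∂P)) := by
  have := strong_law_ae_real (μ := Measure.infinitePi fun _ : ℕ => P)
    (fun k ω => f (ω k)) ?_ ?_ (ident_eval P f hf)
  · rw [integral_eval_f P f hf] at this
    filter_upwards [this] with ω hω
    simpa only [Finset.sum_range] using hω
  · exact (measurePreserving_eval_infinitePi (fun _ : ℕ => P) 0).integrable_comp_of_integrable hi
  · intro i j hij
    exact (iindep_eval P f hf).indepFun hij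

lemma integrable_coord {d : ℕ} (P : Measure (Fin d → ℝ)) [IsProbabilityMeasure P]
    (hint : ∀ i j, Integrable (fun x => x i * x j) P) (i : Fin d) :
    MemLp (fun x => x i) 2 P := by
  rw [memLp_two_iff_integrable_sq (Measurable.aestronglyMeasurable (by fun_prop))]
  simpa [sq] using hint i i

lemma clt_vec (d : ℕ) (P : Measure (Fin d → ℝ)) [IsProbabilityMeasure P]
    [IsProbabilityMeasure (_root_.stdGaussian d)]
    (hmean : ∀ i, ∫ x, x i ∂P = 0)
    (hint : ∀ i j, Integrable (fun x => x i * x j) P)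
    (S A : Matrix (Fin d) (Fin d) ℝ)
    (hS : ∀ i j, S i j = ∫ x, x i * x j ∂P) (hA : A.transpose = A) (hAA : A * A = S) :
    TendstoInDistribution (fun (m : ℕ) (ω : ℕ → Fin d → ℝ) => (√(m : ℝ))⁻¹ • ∑ k : Fin m, ω k)
      atTop (fun ξ => A.mulVec ξ) (fun _ => Measure.infinitePi fun _ => P)
      (_root_.stdGaussian d) := by
  have hmA : Measurable (fun ξ => A.mulVec ξ) := by fun_prop
  suffices H : TendstoInDistribution (fun (m : ℕ) (ω : ℕ → Fin d → ℝ) =>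
      WithLp.toLp 2 ((√(m : ℝ))⁻¹ • ∑ k : Fin m, ω k))
      atTop (fun ξ => WithLp.toLp 2 (A.mulVec ξ)) (fun _ => Measure.infinitePi fun _ => P)
      (_root_.stdGaussian d) from
    H.continuous_comp (g := WithLp.ofLp) (by fun_prop)
  have hmW : ∀ m : ℕ, AEMeasurable (fun (ω : ℕ → Fin d → ℝ) =>
      WithLp.toLp 2 ((√(m : ℝ))⁻¹ • ∑ k : Fin m, ω k)) (Measure.infinitePi fun _ => P) :=
    fun m => Measurable.aemeasurable (by fun_prop)
  refine ⟨hmW, by fun_prop, ?_⟩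
  refine ProbabilityMeasure.tendsto_iff_tendsto_charFun.2 fun t ↦ ?_
  set f : (Fin d → ℝ) → ℝ := fun x => x ⬝ᵥ t.ofLp with hfdef
  have hf : Measurable f := by unfold f dotProduct; fun_prop
  have hfL : MemLp f 2 P := by
    unfold f dotProduct
    exact memLp_finsetSum _ fun i _ => (integrable_coord P hint i).mul_const _
  have hf0 : ∫ x, f x ∂P = 0 := by
    unfold f dotProduct
    rw [integral_finsetSum]
    · simp [integral_mul_const, hmean]
    · exact fun i _ => ((integrable_coord P hint i).integrable (by simp)).mul_const _
  have hv : ∫ x, f x ^ 2 ∂P = t.ofLp ⬝ᵥ S.mulVec t.ofLp := by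
    have : ∀ x, f x ^ 2 = ∑ i, ∑ j, (x i * x j) * (t i * t j) := by
      intro x
      unfold f dotProduct
      rw [sq, Finset.sum_mul_sum]
      refine Finset.sum_congr rfl fun i _ => Finset.sum_congr rfl fun j _ => by ring
    simp_rw [this]
    rw [integral_finsetSum]
    · simp only [dotProduct, Matrix.mulVec, Finset.mul_sum]
      refine Finset.sum_congr rfl fun i _ => ?_
      rw [integral_finsetSum]
      · refine Finset.sum_congr rfl fun j _ => ?_
        rw [integral_mul_const, hS]; ring
      · exact fun j _ => (hint i j).mul_const _
    · exact fun i _ => integrable_finsetSum _ fun j _ => (hint i j).mul_const _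
  set X : ℕ → (ℕ → Fin d → ℝ) → ℝ := fun k ω => f (ω k) with hX
  have hX0 : ∫ ω, X 0 ω ∂(Measure.infinitePi fun _ : ℕ => P) = 0 := by
    rw [← hf0]; exact integral_eval_f P f hf 0
  have hXL : MemLp (X 0) 2 (Measure.infinitePi fun _ : ℕ => P) :=
    hfL.comp_measurePreserving (measurePreserving_eval_infinitePi (fun _ : ℕ => P) 0)
  have hvar : Var[X 0; Measure.infinitePi fun _ : ℕ => P] = t.ofLp ⬝ᵥ S.mulVec t.ofLp := by
    rw [variance_of_integral_eq_zero hXL.aestronglyMeasurable.aemeasurable hX0, ← hv]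
    exact integral_eval_f P (fun x => f x ^ 2) (by fun_prop) 0
  have C := tendstoInDistribution_inv_sqrt_mul_sum_sub (P := Measure.infinitePi fun _ : ℕ => P)
    (X := X) (Y := id) (P' := gaussianReal 0 Var[X 0; Measure.infinitePi fun _ : ℕ => P].toNNReal)
    HasLaw.id hXL (iindep_eval P f hf) (ident_eval P f hf)
  have C2 := ProbabilityMeasure.tendsto_iff_tendsto_charFun.1 C.tendsto 1
  simp only [ProbabilityMeasure.coe_mk, Measure.map_id] at C2 ⊢
  convert C2 using 1
  · ext m
    rw [charFun_apply, charFun_apply, integral_map (hmW m) (by fun_prop),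
      integral_map (C.forall_aemeasurable m) (by fun_prop)]
    congr 1
    ext ω
    congr 3
    rw [hX0]
    simp [EuclideanSpace.inner_eq_star_dotProduct, hX, hfdef, Finset.sum_range, dotProduct_comm]
    exact Or.inl (dotProduct_sum _ _ _)
  · congr 1
    rw [charFun_gaussianReal, hvar]
    rw [charFun_apply, integral_map (by fun_prop) (by fun_prop)]
    have e := charFun_stdGaussian (E := EuclideanSpace ℝ (Fin d)) (WithLp.toLp 2 (A.mulVec t.ofLp))
    rw [← map_pi_eq_stdGaussian, charFun_apply, integral_map (by fun_prop) (by fun_prop)] at e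
    have hn : ‖WithLp.toLp 2 (A.mulVec t.ofLp)‖ ^ 2 = t.ofLp ⬝ᵥ S.mulVec t.ofLp := by
      rw [← real_inner_self_eq_norm_sq, EuclideanSpace.inner_eq_star_dotProduct, ← hAA,
        ← Matrix.mulVec_mulVec]
      simp only [star_trivial]
      rw [Matrix.dotProduct_mulVec t.ofLp, ← Matrix.mulVec_transpose, hA]
    have hnn : 0 ≤ t.ofLp ⬝ᵥ S.mulVec t.ofLp := by rw [← hn]; positivity
    have hr : Complex.exp (((1 : ℝ) : ℂ) * ((0 : ℝ) : ℂ) * Complex.I -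
        (((t.ofLp ⬝ᵥ S.mulVec t.ofLp).toNNReal : ℝ) : ℂ) * ((1 : ℝ) : ℂ) ^ 2 / 2) =
        Complex.exp (-(‖WithLp.toLp 2 (A.mulVec t.ofLp)‖ : ℂ) ^ 2 / 2) := by
      rw [Real.coe_toNNReal _ hnn, ← hn]
      congr 1
      push_cast
      ring
    refine Eq.trans ?_ (e.trans hr.symm)
    unfold _root_.stdGaussian
    congr 1
    ext x
    congr 3
    rw [EuclideanSpace.inner_eq_star_dotProduct, EuclideanSpace.inner_eq_star_dotProduct]
    simp only [star_trivial]
    rw [Matrix.dotProduct_mulVec t.ofLp, ← Matrix.mulVec_transpose, hA]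

/-- Normalized mean and sample covariance of a half sample. -/
def cfStat (d m : ℕ) (x : Fin m → Fin d → ℝ) : (Fin d → ℝ) × (Fin d → Fin d → ℝ) :=
  ((√(m : ℝ))⁻¹ • ∑ i, x i,
    fun j k => (∑ i, (x i j - (∑ l, x l j) / m) * (x i k - (∑ l, x l k) / m)) / m)

/-- The quadratic form attached to an array. -/
def cfQuad {d : ℕ} (V : Fin d → Fin d → ℝ) (z : Fin d → ℝ) : ℝ :=
  ∑ j, ∑ k, z j * z k * V j k

/-- The statistic as a function of the normalized means and sample covariances. -/
def cfF {d : ℕ} (p : ((Fin d → ℝ) × (Fin d → Fin d → ℝ)) × ((Fin d → ℝ) × (Fin d → Fin d → ℝ))) :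
    ℝ :=
  dot p.1.1 p.2.1 / √(cfQuad p.1.2 p.2.1) + dot p.2.1 p.1.1 / √(cfQuad p.2.2 p.1.1)

lemma cf_half (d m : ℕ) (hm : 0 < m) (x : Fin m → Fin d → ℝ) (t : Fin d → ℝ) (c : ℝ) :
    √(m : ℝ) * (c / m) /
      √((∑ i, dot (fun j => t j / m) (fun j => x i j - (∑ l, x l j) / m) ^ 2) / m) =
    c / √(cfQuad (cfStat d m x).2 ((√(m : ℝ))⁻¹ • t)) := by
  have hm' : (0 : ℝ) < m := by exact_mod_cast hm
  have hq : (∑ i, dot (fun j => t j / m) (fun j => x i j - (∑ l, x l j) / m) ^ 2) / m =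
      cfQuad (cfStat d m x).2 ((√(m : ℝ))⁻¹ • t) / m := by
    congr 1
    have h1 : ∀ i, dot (fun j => t j / m) (fun j => x i j - (∑ l, x l j) / m) ^ 2 =
        ∑ j, ∑ k, (t j / m) * (t k / m) *
          ((x i j - (∑ l, x l j) / m) * (x i k - (∑ l, x l k) / m)) := by
      intro i
      rw [dot, sq, Finset.sum_mul_sum]
      refine Finset.sum_congr rfl fun j _ => Finset.sum_congr rfl fun k _ => by ring
    simp_rw [h1]
    rw [Finset.sum_comm]
    unfold cfQuad
    refine Finset.sum_congr rfl fun j _ => ?_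
    rw [Finset.sum_comm]
    refine Finset.sum_congr rfl fun k _ => ?_
    rw [← Finset.mul_sum]
    simp only [cfStat, Pi.smul_apply, smul_eq_mul]
    have h2 : (√(m : ℝ))⁻¹ * (√(m : ℝ))⁻¹ = (m : ℝ)⁻¹ := by
      rw [← mul_inv, Real.mul_self_sqrt hm'.le]
    calc _ = (m : ℝ)⁻¹ * t j * t k * ((∑ i, (x i j - (∑ l, x l j) / m) *
          (x i k - (∑ l, x l k) / m)) / m) := by field_simp
      _ = _ := by rw [← h2]; ring
  rw [hq, Real.sqrt_div' _ hm'.le]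
  have hs : 0 < √(m : ℝ) := Real.sqrt_pos.2 hm'
  have hss : √(m : ℝ) * √(m : ℝ) = m := Real.mul_self_sqrt hm'.le
  rw [div_div_eq_mul_div]
  congr 1
  rw [mul_right_comm, hss]
  field_simp

lemma cf_repr (d m : ℕ) (hm : 0 < m) (x y : Fin m → Fin d → ℝ) :
    TmeanCross d m (Fin.append x y) = cfF (cfStat d m x, cfStat d m y) := by
  have hm' : (0 : ℝ) < m := by exact_mod_cast hm
  have h2 : (√(m : ℝ))⁻¹ * (√(m : ℝ))⁻¹ = (m : ℝ)⁻¹ := by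
    rw [← mul_inv, Real.mul_self_sqrt hm'.le]
  have hd : ∀ x y : Fin m → Fin d → ℝ,
      dot (fun j => (∑ i, x i j) / (m : ℝ)) (fun j => (∑ i, y i j) / (m : ℝ)) =
        dot (cfStat d m x).1 (cfStat d m y).1 / m := by
    intro x y
    simp only [dot, cfStat, Pi.smul_apply, smul_eq_mul, Finset.sum_apply, Finset.sum_div]
    refine Finset.sum_congr rfl fun j _ => ?_
    rw [← Finset.sum_div, ← Finset.sum_div]
    calc _ = (m : ℝ)⁻¹ * ((∑ i, x i j) * (∑ i, y i j)) / m := by ring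
      _ = _ := by rw [← h2]; ring
  have e1 := cf_half d m hm x (fun j => ∑ i, y i j) (dot (cfStat d m x).1 (cfStat d m y).1)
  have e2 := cf_half d m hm y (fun j => ∑ i, x i j) (dot (cfStat d m y).1 (cfStat d m x).1)
  have hz : ∀ x : Fin m → Fin d → ℝ, (√(m : ℝ))⁻¹ • (fun j => ∑ i, x i j) = (cfStat d m x).1 := by
    intro x; ext j; simp [cfStat]
  rw [hz] at e1 e2
  simp only [TmeanCross, Fin.append_left, Fin.append_right, cfF]
  rw [hd, hd, e1, e2]

lemma cfStat_measurable (d m : ℕ) : Measurable (cfStat d m) := by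
  unfold cfStat
  fun_prop

lemma cfF_measurable (d : ℕ) : Measurable (cfF (d := d)) := by
  unfold cfF cfQuad dot
  fun_prop

lemma cfQuad_continuous (d : ℕ) :
    Continuous (fun p : (Fin d → Fin d → ℝ) × (Fin d → ℝ) => cfQuad p.1 p.2) := by
  unfold cfQuad
  fun_prop

/-- The open set where the limit functional is continuous. -/
def cfU (d : ℕ) : Set (((Fin d → ℝ) × (Fin d → Fin d → ℝ)) × ((Fin d → ℝ) × (Fin d → Fin d → ℝ))) :=
  {p | 0 < cfQuad p.1.2 p.2.1 ∧ 0 < cfQuad p.2.2 p.1.1}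

lemma cfU_open (d : ℕ) : IsOpen (cfU d) := by
  have h1 := (cfQuad_continuous d).comp (f := fun p : ((Fin d → ℝ) × (Fin d → Fin d → ℝ)) ×
    ((Fin d → ℝ) × (Fin d → Fin d → ℝ)) => (p.1.2, p.2.1)) (by fun_prop)
  have h2 := (cfQuad_continuous d).comp (f := fun p : ((Fin d → ℝ) × (Fin d → Fin d → ℝ)) ×
    ((Fin d → ℝ) × (Fin d → Fin d → ℝ)) => (p.2.2, p.1.1)) (by fun_prop)
  exact (isOpen_lt continuous_const h1).inter (isOpen_lt continuous_const h2)

lemma cfF_contOn (d : ℕ) : ContinuousOn (cfF (d := d)) (cfU d) := by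
  unfold cfF
  refine ContinuousOn.add (ContinuousOn.div ?_ ?_ ?_) (ContinuousOn.div ?_ ?_ ?_)
  · unfold dot; fun_prop
  · unfold cfQuad; fun_prop
  · exact fun p hp => (Real.sqrt_pos.2 hp.1).ne'
  · unfold dot; fun_prop
  · unfold cfQuad; fun_prop
  · exact fun p hp => (Real.sqrt_pos.2 hp.2).ne'

lemma cfCov_ae (d : ℕ) (P : Measure (Fin d → ℝ)) [IsProbabilityMeasure P]
    (hmean : ∀ i, ∫ x, x i ∂P = 0)
    (hint : ∀ i j, Integrable (fun x => x i * x j) P)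
    (S : Matrix (Fin d) (Fin d) ℝ)
    (hS : ∀ i j, S i j = ∫ x, x i * x j ∂P) :
    ∀ᵐ ω ∂(Measure.infinitePi fun _ : ℕ => P),
      Tendsto (fun m : ℕ => (cfStat d m (fun i => ω i)).2) atTop (𝓝 (fun i j => S i j)) := by
  have h1 : ∀ j, ∀ᵐ ω ∂(Measure.infinitePi fun _ : ℕ => P),
      Tendsto (fun n : ℕ => (∑ i : Fin n, ω i j) / (n : ℝ)) atTop (𝓝 (∫ x, x j ∂P)) := fun j =>
    lln_real P (fun x => x j) (by fun_prop) ((integrable_coord P hint j).integrable (by simp))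
  have h2 : ∀ j k, ∀ᵐ ω ∂(Measure.infinitePi fun _ : ℕ => P),
      Tendsto (fun n : ℕ => (∑ i : Fin n, ω i j * ω i k) / (n : ℝ)) atTop
        (𝓝 (∫ x, x j * x k ∂P)) := fun j k =>
    lln_real P (fun x => x j * x k) (by fun_prop) (hint j k)
  filter_upwards [ae_all_iff.2 h1, ae_all_iff.2 fun j => ae_all_iff.2 (h2 j)] with ω g1 g2
  rw [tendsto_pi_nhds]
  intro j
  rw [tendsto_pi_nhds]
  intro k
  have := (g2 j k).sub ((g1 j).mul (g1 k))
  rw [hmean, hmean, mul_zero, sub_zero, ← hS] at this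
  refine this.congr' ?_
  filter_upwards [eventually_gt_atTop 0] with m hm
  have hm' : (m : ℝ) ≠ 0 := by positivity
  simp only [cfStat, sub_mul, mul_sub, Finset.sum_sub_distrib, ← Finset.sum_mul, ← Finset.mul_sum,
    Finset.sum_const, Finset.card_univ, Fintype.card_fin, nsmul_eq_mul]
  field_simp
  ring

instance (d : ℕ) : IsProbabilityMeasure (_root_.stdGaussian d) := by
  unfold _root_.stdGaussian; infer_instance

lemma cfStat_tendsto (d : ℕ) (P : Measure (Fin d → ℝ)) [IsProbabilityMeasure P]
    (hmean : ∀ i, ∫ x, x i ∂P = 0)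
    (hint : ∀ i j, Integrable (fun x => x i * x j) P)
    (S A : Matrix (Fin d) (Fin d) ℝ)
    (hS : ∀ i j, S i j = ∫ x, x i * x j ∂P) (hA : A.transpose = A) (hAA : A * A = S) :
    TendstoInDistribution (fun (m : ℕ) (ω : ℕ → Fin d → ℝ) => cfStat d m (fun i => ω i))
      atTop (fun ξ => (A.mulVec ξ, fun i j => S i j)) (fun _ => Measure.infinitePi fun _ => P)
      (_root_.stdGaussian d) := by
  have hmeas : ∀ m : ℕ, AEMeasurable (fun ω : ℕ → Fin d → ℝ => (cfStat d m (fun i => ω i)).2)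
      (Measure.infinitePi fun _ => P) := fun m => by
    have := cfStat_measurable d m
    exact Measurable.aemeasurable (by fun_prop)
  have h1 := clt_vec d P hmean hint S A hS hA hAA
  have h2 : TendstoInMeasure (Measure.infinitePi fun _ : ℕ => P)
      (fun (m : ℕ) (ω : ℕ → Fin d → ℝ) => (cfStat d m (fun i => ω i)).2) atTop
      (fun _ => (fun i j => S i j : Fin d → Fin d → ℝ)) :=
    tendstoInMeasure_of_tendsto_ae (fun m => (hmeas m).aestronglyMeasurable)
      (cfCov_ae d P hmean hint S hS)
  have h3 := TendstoInDistribution.prodMk_of_tendstoInMeasure_const _ _ _ h1 h2 hmeas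
  exact h3

lemma map_restrict_fin (d m : ℕ) (P : Measure (Fin d → ℝ)) [IsProbabilityMeasure P] :
    (Measure.infinitePi fun _ : ℕ => P).map (fun ω (i : Fin m) => ω i) =
      Measure.pi fun _ : Fin m => P := by
  have := Measure.map_infinitePi_infinitePi_of_inj (P := fun _ : ℕ => P)
    (f := fun i : Fin m => (i : ℕ)) Fin.val_injective
  rw [this, Measure.infinitePi_eq_pi]

lemma append_mp (d m : ℕ) (P : Measure (Fin d → ℝ)) [IsProbabilityMeasure P] :
    MeasurePreserving (fun p : (Fin m → Fin d → ℝ) × (Fin m → Fin d → ℝ) => Fin.append p.1 p.2)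
      ((Measure.pi fun _ => P).prod (Measure.pi fun _ => P)) (Measure.pi fun _ => P) := by
  have hmeas : Measurable (fun p : (Fin m → Fin d → ℝ) × (Fin m → Fin d → ℝ) =>
      Fin.append p.1 p.2) := by
    rw [measurable_pi_iff]
    intro i
    refine Fin.addCases (fun i => ?_) (fun i => ?_) i
    · simp only [Fin.append_left]; fun_prop
    · simp only [Fin.append_right]; fun_prop
  refine ⟨hmeas, ?_⟩
  symm
  apply Measure.pi_eq
  intro s hs
  rw [Measure.map_apply hmeas (MeasurableSet.univ_pi hs)]
  have : (fun p : (Fin m → Fin d → ℝ) × (Fin m → Fin d → ℝ) => Fin.append p.1 p.2) ⁻¹'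
      (Set.univ.pi s) = (Set.univ.pi fun i => s (Fin.castAdd m i)) ×ˢ
        (Set.univ.pi fun i => s (Fin.natAdd m i)) := by
    ext p
    simp only [Set.mem_preimage, Set.mem_univ_pi, Set.mem_prod]
    constructor
    · intro h
      exact ⟨fun i => by simpa using h (Fin.castAdd m i), fun i => by
        have := h (Fin.natAdd m i)
        rwa [Fin.append_right] at this⟩
    · rintro ⟨h1, h2⟩ i
      refine Fin.addCases (fun i => ?_) (fun i => ?_) i
      · simpa using h1 i
      · rw [Fin.append_right]; exact h2 i
  rw [this, Measure.prod_prod, Measure.pi_pi, Measure.pi_pi, Fin.prod_univ_add]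

lemma cf_zero_ae (d : ℕ) (hd : d ≠ 0) : ∀ᵐ ξ ∂(_root_.stdGaussian d), ξ ≠ 0 := by
  have : Nonempty (Fin d) := ⟨⟨0, Nat.pos_of_ne_zero hd⟩⟩
  have : NullSingletonClass (gaussianReal 0 1) := nullSingletonClass_gaussianReal one_ne_zero
  have h : (_root_.stdGaussian d) {0} = 0 := by
    unfold _root_.stdGaussian
    exact measure_singleton _
  rw [ae_iff]
  simpa using h

lemma cfQuad_eq {d : ℕ} (S : Matrix (Fin d) (Fin d) ℝ) (z : Fin d → ℝ) :
    cfQuad (fun i j => S i j) z = z ⬝ᵥ S.mulVec z := by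
  simp only [cfQuad, dotProduct, Matrix.mulVec, Finset.mul_sum]
  refine Finset.sum_congr rfl fun j _ => Finset.sum_congr rfl fun k _ => by ring

open scoped MatrixOrder in
lemma cf_sqrt {d : ℕ} (S : Matrix (Fin d) (Fin d) ℝ) (hsymm : S.transpose = S)
    (hpd : ∀ u : Fin d → ℝ, u ≠ 0 → 0 < dot u (S.mulVec u)) :
    ∃ A : Matrix (Fin d) (Fin d) ℝ, A.transpose = A ∧ A * A = S := by
  have hS : S.PosSemidef := by
    refine Matrix.PosSemidef.of_dotProduct_mulVec_nonneg ?_ ?_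
    · rw [Matrix.IsHermitian, Matrix.conjTranspose_eq_transpose_of_trivial, hsymm]
    · intro x
      rw [star_trivial]
      by_cases hx : x = 0
      · simp [hx]
      · exact (hpd x hx).le
  refine ⟨CFC.sqrt S, ?_, CFC.sqrt_mul_sqrt_self S hS.nonneg⟩
  have h := (CFC.sqrt_nonneg S).isSelfAdjoint
  rw [← Matrix.conjTranspose_eq_transpose_of_trivial]
  exact h

theorem crossfit_limiting_distribution
    (d : ℕ) (P : Measure (Fin d → ℝ)) (hP : IsProbabilityMeasure P)
    (hmean : ∀ i, ∫ x, x i ∂P = 0)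
    (hint : ∀ i j, Integrable (fun x => x i * x j) P)
    (S : Matrix (Fin d) (Fin d) ℝ)
    (hS : ∀ i j, S i j = ∫ x, x i * x j ∂P)
    (hpd : ∀ u : Fin d → ℝ, u ≠ 0 → 0 < dot u (S.mulVec u)) :
    ∀ g : BoundedContinuousFunction ℝ ℝ,
      Tendsto (fun m =>
          ∫ ω : Fin (m + m) → Fin d → ℝ, g (TmeanCross d m ω)
            ∂(Measure.pi fun _ => P))
        atTop
        (nhds (∫ ξ : (Fin d → ℝ) × (Fin d → ℝ),
            g (dot ξ.1 (S.mulVec ξ.2) / Real.sqrt (dot ξ.1 ((S * S).mulVec ξ.1)) +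
                dot ξ.1 (S.mulVec ξ.2) / Real.sqrt (dot ξ.2 ((S * S).mulVec ξ.2)))
          ∂((stdGaussian d).prod (stdGaussian d)))) := by
  intro g
  rcases eq_or_ne d 0 with rfl | hd
  · have h1 : ∀ m ω, TmeanCross 0 m ω = 0 := by
      intro m ω; simp [TmeanCross, dot]
    simp only [h1]
    simp [dot]
  have hsymm : S.transpose = S := by
    ext i j
    rw [Matrix.transpose_apply, hS, hS]
    simp only [mul_comm]
  obtain ⟨A, hA, hAA⟩ := cf_sqrt S hsymm hpd
  have H := cfStat_tendsto d P hmean hint S A hS hA hAA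
  have Hp := (ProbabilityMeasure.continuous_prod.tendsto _).comp
    (H.tendsto.prodMk_nhds H.tendsto)
  have hsw : ∀ x y : Fin d → ℝ, A.mulVec x ⬝ᵥ y = x ⬝ᵥ A.mulVec y := by
    intro x y
    rw [Matrix.dotProduct_mulVec, ← Matrix.mulVec_transpose, hA]
  set Z : (Fin d → ℝ) → (Fin d → ℝ) × (Fin d → Fin d → ℝ) :=
    fun ξ => (A.mulVec ξ, fun i j => S i j) with hZ
  have hZm : Measurable Z := by unfold Z; fun_prop
  have hq : ∀ ξ : Fin d → ℝ, cfQuad (fun i j => S i j) (A.mulVec ξ) =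
      dot ξ ((S * S).mulVec ξ) := by
    intro ξ
    rw [cfQuad_eq, hsw, dot_eq, Matrix.mulVec_mulVec, Matrix.mulVec_mulVec, ← hAA]
    simp only [mul_assoc]
  have hpos : ∀ ξ : Fin d → ℝ, ξ ≠ 0 → 0 < cfQuad (fun i j => S i j) (A.mulVec ξ) := by
    intro ξ hξ
    rw [cfQuad_eq]
    apply hpd
    intro h0
    have := hpd ξ hξ
    rw [← hAA, ← Matrix.mulVec_mulVec, h0, Matrix.mulVec_zero, dot_eq, dotProduct_zero] at this
    exact lt_irrefl _ this
  have hU : ∀ᵐ p ∂(((_root_.stdGaussian d).map Z).prod ((_root_.stdGaussian d).map Z)),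
      p ∈ cfU d := by
    rw [Measure.map_prod_map _ _ hZm hZm]
    refine (ae_map_iff (p := fun p => p ∈ cfU d) (hZm.prodMap hZm).aemeasurable
      (cfU_open d).measurableSet).2 ?_
    have a1 := Measure.quasiMeasurePreserving_fst (μ := _root_.stdGaussian d)
      (ν := _root_.stdGaussian d) |>.ae (cf_zero_ae d hd)
    have a2 := Measure.quasiMeasurePreserving_snd (μ := _root_.stdGaussian d)
      (ν := _root_.stdGaussian d) |>.ae (cf_zero_ae d hd)
    filter_upwards [a1, a2] with p h1 h2
    exact ⟨hpos _ h2, hpos _ h1⟩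
  have T := aux_cont_map Hp (cfF_measurable d) (cfU_open d) (cfF_contOn d) hU g
  have hgm : Measurable (fun p => g (cfF (d := d) p)) :=
    g.continuous.measurable.comp (cfF_measurable d)
  have hlim : ∫ x, g (cfF x) ∂(((_root_.stdGaussian d).map Z).prod ((_root_.stdGaussian d).map Z)) =
      ∫ ξ : (Fin d → ℝ) × (Fin d → ℝ),
            g (dot ξ.1 (S.mulVec ξ.2) / Real.sqrt (dot ξ.1 ((S * S).mulVec ξ.1)) +
                dot ξ.1 (S.mulVec ξ.2) / Real.sqrt (dot ξ.2 ((S * S).mulVec ξ.2)))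
          ∂((_root_.stdGaussian d).prod (_root_.stdGaussian d)) := by
    rw [Measure.map_prod_map _ _ hZm hZm,
      integral_map (by fun_prop) hgm.aestronglyMeasurable]
    congr 1
    ext ξ
    congr 1
    have e1 : dot (A.mulVec ξ.1) (A.mulVec ξ.2) = dot ξ.1 (S.mulVec ξ.2) := by
      rw [dot_eq, hsw, Matrix.mulVec_mulVec, hAA, dot_eq]
    have e2 : dot (A.mulVec ξ.2) (A.mulVec ξ.1) = dot ξ.1 (S.mulVec ξ.2) := by
      rw [← e1, dot_eq, dot_eq, dotProduct_comm]
    simp only [cfF, Prod.map, hZ, hq, e1, e2]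
    rw [add_comm]
  rw [← hlim]
  refine Tendsto.congr' ?_ T
  filter_upwards [eventually_gt_atTop 0] with m hm
  have hst := cfStat_measurable d m
  have hr : Measurable (fun (ω : ℕ → Fin d → ℝ) (i : Fin m) => ω i) := by fun_prop
  have hmap : (Measure.infinitePi fun _ : ℕ => P).map (fun ω => cfStat d m (fun i => ω i)) =
      (Measure.pi fun _ : Fin m => P).map (cfStat d m) := by
    rw [← map_restrict_fin d m P, Measure.map_map hst hr]
    rfl
  have hA1 := append_mp d m P
  change ∫ x, g (cfF x) ∂(((Measure.infinitePi fun _ : ℕ => P).map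
    (fun ω => cfStat d m (fun i => ω i))).prod ((Measure.infinitePi fun _ : ℕ => P).map
    (fun ω => cfStat d m (fun i => ω i)))) = _
  have hTm : Measurable (TmeanCross d m) := by
    unfold TmeanCross dot
    fun_prop
  have hgT : Measurable (fun ω => g (TmeanCross d m ω)) := g.continuous.measurable.comp hTm
  rw [hmap, Measure.map_prod_map _ _ hst hst, integral_map (by fun_prop) hgm.aestronglyMeasurable,
    ← hA1.map_eq, integral_map hA1.measurable.aemeasurable
      hgT.aestronglyMeasurable]
  congr 1
  ext p
  rw [cf_repr d m hm]
  rfl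

end
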